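/- Let α ∈ ℝ, let u: ℝ × ℝⁿ → ℝⁿ be smooth with momentum m_i = u_i − α²Δu_i, and let w: ℝ × ℝⁿ → ℝⁿ be smooth and compactly supported in spacetime. Then ∫_ℝ ∫_{ℝⁿ} Σ_i m_i ( ∂_t w_i + Σ_j u_j ∂_j w_i − Σ_j w_j ∂_j u_i ) dx dt = −∫_ℝ ∫_{ℝⁿ} Σ_i ( ∂_t m_i + Σ_j u_j ∂_j m_i + Σ_j m_j ∂_i u_j + m_i div u ) w_i dx dt. In particular, if u solves the EPDiff equation, then ∫∫ m · δu dx dt = 0 for every constrained (Lin-type) variation δu = ∂_t w + u·∇w − w·∇u with w smooth and compactly supported, which is the constrained variational principle δ∫ℓ(u)dt = 0 generating EPDiff. -/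

import Mathlib

open MeasureTheory

/-- Partial derivative ∂ⱼf of a scalar function on ℝⁿ. -/
noncomputable def pd {n : ℕ} (f : (Fin n → ℝ) → ℝ) (j : Fin n) : (Fin n → ℝ) → ℝ :=
  fun x => fderiv ℝ f x (Pi.single j 1)

/-- Laplacian Δf = Σₖ ∂ₖ²f of a scalar function on ℝⁿ. -/
noncomputable def lap {n : ℕ} (f : (Fin n → ℝ) → ℝ) : (Fin n → ℝ) → ℝ :=
  fun x => ∑ k, pd (pd f k) k x

section helpers

lemma pd_slice {n : ℕ} (f : ℝ × (Fin n → ℝ) → ℝ) (hf : ContDiff ℝ (⊤ : ℕ∞) f) (t : ℝ)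
    (j : Fin n) (x : Fin n → ℝ) :
    pd (fun y => f (t, y)) j x = fderiv ℝ f (t, x) (0, Pi.single j 1) := by
  have h1 : HasFDerivAt f (fderiv ℝ f (t, x)) (t, x) :=
    (hf.differentiable (by simp) (t, x)).hasFDerivAt
  have h2 := h1.comp x (hasFDerivAt_prodMk_right t x)
  have h3 : fderiv ℝ (fun y => f (t, y)) x = _ := h2.fderiv
  simp [pd, h3]

lemma deriv_slice {n : ℕ} (f : ℝ × (Fin n → ℝ) → ℝ) (hf : ContDiff ℝ (⊤ : ℕ∞) f) (t : ℝ)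
    (x : Fin n → ℝ) :
    deriv (fun s => f (s, x)) t = fderiv ℝ f (t, x) (1, 0) := by
  have h1 : HasFDerivAt f (fderiv ℝ f (t, x)) (t, x) :=
    (hf.differentiable (by simp) (t, x)).hasFDerivAt
  have h2 := (h1.comp t (hasFDerivAt_prodMk_left t x)).hasDerivAt
  have h3 : deriv (fun s => f (s, x)) t = _ := h2.deriv
  simp [h3]

lemma smooth_D {n : ℕ} {f : ℝ × (Fin n → ℝ) → ℝ} (hf : ContDiff ℝ (⊤ : ℕ∞) f)
    (v : ℝ × (Fin n → ℝ)) : ContDiff ℝ (⊤ : ℕ∞) (fun p => fderiv ℝ f p v) :=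
  (hf.fderiv_right (m := (⊤ : ℕ∞)) (by norm_cast)).clm_apply contDiff_const

lemma integral_D {n : ℕ} {f : ℝ × (Fin n → ℝ) → ℝ} (hf : ContDiff ℝ (⊤ : ℕ∞) f)
    (hc : HasCompactSupport f) (v : ℝ × (Fin n → ℝ)) :
    Integrable (fun p => fderiv ℝ f p v) ∧ ∫ p, fderiv ℝ f p v = 0 := by
  have hi : Integrable (fun p => fderiv ℝ f p v) :=
    (smooth_D hf v).continuous.integrable_of_hasCompactSupport (hc.fderiv_apply (𝕜 := ℝ) v)
  refine ⟨hi, ?_⟩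
  have : (volume : Measure (ℝ × (Fin n → ℝ))).IsAddHaarMeasure :=
    inferInstanceAs ((volume : Measure ℝ).prod (volume : Measure (Fin n → ℝ))).IsAddHaarMeasure
  have := integral_mul_fderiv_eq_neg_fderiv_mul_of_integrable (μ := volume)
    (f := fun _ : ℝ × (Fin n → ℝ) => (1 : ℝ)) (g := f) (v := v) (by simp) (by simpa using hi)
    (by simpa using hf.continuous.integrable_of_hasCompactSupport hc)
    (by simp) (fun x _ => hf.differentiable (by simp) x)
  simpa using this

lemma main_aux {n : ℕ} (U M W : Fin n → ℝ × (Fin n → ℝ) → ℝ)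
    (hU : ∀ i, ContDiff ℝ (⊤ : ℕ∞) (U i)) (hM : ∀ i, ContDiff ℝ (⊤ : ℕ∞) (M i))
    (hW : ∀ i, ContDiff ℝ (⊤ : ℕ∞) (W i)) (hc : ∀ i, HasCompactSupport (W i))
    (L R : ℝ × (Fin n → ℝ) → ℝ)
    (hL : ∀ p, L p = ∑ i, M i p * (fderiv ℝ (W i) p (1, 0)
      + ∑ j, U j p * fderiv ℝ (W i) p (0, Pi.single j 1)
      - ∑ j, W j p * fderiv ℝ (U i) p (0, Pi.single j 1)))
    (hR : ∀ p, R p = ∑ i, (fderiv ℝ (M i) p (1, 0)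
      + ∑ j, U j p * fderiv ℝ (M i) p (0, Pi.single j 1)
      + ∑ j, M j p * fderiv ℝ (U j) p (0, Pi.single i 1)
      + M i p * ∑ j, fderiv ℝ (U j) p (0, Pi.single j 1)) * W i p) :
    ∫ t : ℝ, ∫ x : Fin n → ℝ, L (t, x) = - ∫ t : ℝ, ∫ x : Fin n → ℝ, R (t, x) := by
  have d : ∀ {f : ℝ × (Fin n → ℝ) → ℝ}, ContDiff ℝ (⊤ : ℕ∞) f → ∀ p, DifferentiableAt ℝ f p :=
    fun h p => h.differentiable (by simp) p
  have hRi : Integrable R := by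
    have : R = fun p => _ := funext hR
    rw [this]
    refine integrable_finsetSum _ fun i _ => ?_
    refine Continuous.integrable_of_hasCompactSupport ?_ ((hc i).mul_left)
    have a := fun i v => (smooth_D (hM i) v).continuous
    have b := fun i v => (smooth_D (hU i) v).continuous
    have c1 := fun i => (hM i).continuous
    have c2 := fun i => (hU i).continuous
    have c3 := fun i => (hW i).continuous
    fun_prop
  have h1 : ∀ i, _ := fun i => integral_D ((hM i).mul (hW i)) ((hc i).mul_left) (1, 0)
  have h2 : ∀ i j, _ := fun i j => integral_D ((hU j).mul ((hM i).mul (hW i)))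
    (((hc i).mul_left).mul_left) (0, Pi.single j 1)
  have key : ∀ p, L p = (∑ i, (fderiv ℝ (fun p => M i p * W i p) p (1, 0)
      + ∑ j, fderiv ℝ (fun p => U j p * (M i p * W i p)) p (0, Pi.single j 1))) - R p := by
    intro p
    have e1 : ∀ i v, fderiv ℝ (fun p => M i p * W i p) p v
        = M i p * fderiv ℝ (W i) p v + W i p * fderiv ℝ (M i) p v := by
      intro i v
      rw [fderiv_fun_mul (d (hM i) p) (d (hW i) p)]
      simp
    have e2 : ∀ i j v, fderiv ℝ (fun p => U j p * (M i p * W i p)) p v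
        = U j p * (M i p * fderiv ℝ (W i) p v + W i p * fderiv ℝ (M i) p v)
          + M i p * W i p * fderiv ℝ (U j) p v := by
      intro i j v
      rw [fderiv_fun_mul (d (hU j) p) (d ((hM i).mul (hW i)) p)]
      simp [← e1]
    have sw : ∑ i, ∑ j, M i p * (W j p * fderiv ℝ (U i) p (0, Pi.single j 1))
        = ∑ i, ∑ j, M j p * fderiv ℝ (U j) p (0, Pi.single i 1) * W i p := by
      rw [Finset.sum_comm]
      exact Finset.sum_congr rfl fun _ _ => Finset.sum_congr rfl fun _ _ => by ring
    rw [hL, hR]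
    simp only [e1, e2, mul_add, add_mul, mul_sub, Finset.sum_add_distrib, Finset.sum_sub_distrib,
      Finset.mul_sum, Finset.sum_mul, sw]
    have c1 : ∑ i, W i p * fderiv ℝ (M i) p (1, 0) = ∑ i, fderiv ℝ (M i) p (1, 0) * W i p :=
      Finset.sum_congr rfl fun _ _ => by ring
    have c2 : ∑ i, ∑ j, U j p * (W i p * fderiv ℝ (M i) p (0, Pi.single j 1))
        = ∑ i, ∑ j, U j p * fderiv ℝ (M i) p (0, Pi.single j 1) * W i p :=
      Finset.sum_congr rfl fun _ _ => Finset.sum_congr rfl fun _ _ => by ring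
    have c3 : ∑ i, ∑ j, M i p * W i p * fderiv ℝ (U j) p (0, Pi.single j 1)
        = ∑ i, ∑ j, M i p * fderiv ℝ (U j) p (0, Pi.single j 1) * W i p :=
      Finset.sum_congr rfl fun _ _ => Finset.sum_congr rfl fun _ _ => by ring
    have c4 : ∑ i, ∑ j, U j p * (M i p * fderiv ℝ (W i) p (0, Pi.single j 1))
        = ∑ i, ∑ j, M i p * (U j p * fderiv ℝ (W i) p (0, Pi.single j 1)) :=
      Finset.sum_congr rfl fun _ _ => Finset.sum_congr rfl fun _ _ => by ring
    rw [c1, c2, c3, c4]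
    ring
  have hs : ∀ i, Integrable (fun p => ∑ j,
      fderiv ℝ (fun p => U j p * (M i p * W i p)) p (0, Pi.single j 1)) := fun i =>
    integrable_finsetSum _ fun j _ => (h2 i j).1
  have hd : Integrable (fun p => ∑ i, (fderiv ℝ (fun p => M i p * W i p) p (1, 0)
      + ∑ j, fderiv ℝ (fun p => U j p * (M i p * W i p)) p (0, Pi.single j 1))) :=
    integrable_finsetSum _ fun i _ => (h1 i).1.add (hs i)
  have hLi : Integrable L := by
    rw [funext key]
    exact hd.sub hRi
  have hE : ∫ p, L p = - ∫ p, R p := by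
    rw [funext key, integral_sub hd hRi,
      integral_finsetSum _ fun i _ => by exact (h1 i).1.add (hs i)]
    rw [Finset.sum_eq_zero, zero_sub]
    intro i _
    refine (integral_add (h1 i).1 (hs i)).trans ?_
    rw [integral_finsetSum _ fun j _ => (h2 i j).1, Finset.sum_eq_zero fun j _ => (h2 i j).2]
    rw [add_zero]
    exact (h1 i).2
  rw [← integral_prod L hLi, ← integral_prod R hRi]
  exact hE

end helpers

/-- integration by parts against Lin-type constrained variations
δu = ∂ₜw + u·∇w − w·∇u yields the EPDiff operator; in particular solutions of EPDiff
satisfy the constrained variational principle ∫∫ m·δu dx dt = 0. -/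
theorem epdiff_constrained_variational_principle (n : ℕ) (α : ℝ)
    (u : ℝ → (Fin n → ℝ) → Fin n → ℝ)
    (hu : ContDiff ℝ (⊤ : ℕ∞) (fun p : ℝ × (Fin n → ℝ) => u p.1 p.2))
    (m : ℝ → (Fin n → ℝ) → Fin n → ℝ)
    (hm : ∀ t x i, m t x i = u t x i - α ^ 2 * lap (fun y => u t y i) x)
    (w : ℝ → (Fin n → ℝ) → Fin n → ℝ)
    (hw : ContDiff ℝ (⊤ : ℕ∞) (fun p : ℝ × (Fin n → ℝ) => w p.1 p.2))
    (hwc : HasCompactSupport (fun p : ℝ × (Fin n → ℝ) => w p.1 p.2)) :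
    (∫ t : ℝ, ∫ x : Fin n → ℝ, ∑ i, m t x i *
        (deriv (fun s => w s x i) t + ∑ j, u t x j * pd (fun y => w t y i) j x
          - ∑ j, w t x j * pd (fun y => u t y i) j x)
      = -∫ t : ℝ, ∫ x : Fin n → ℝ, ∑ i,
          (deriv (fun s => m s x i) t + ∑ j, u t x j * pd (fun y => m t y i) j x
            + ∑ j, m t x j * pd (fun y => u t y j) i x
            + m t x i * ∑ j, pd (fun y => u t y j) j x) * w t x i) ∧
    ((∀ t x (i : Fin n),
        deriv (fun s => m s x i) t + ∑ j, u t x j * pd (fun y => m t y i) j x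
          + ∑ j, m t x j * pd (fun y => u t y j) i x
          + m t x i * ∑ j, pd (fun y => u t y j) j x = 0) →
      ∫ t : ℝ, ∫ x : Fin n → ℝ, ∑ i, m t x i *
        (deriv (fun s => w s x i) t + ∑ j, u t x j * pd (fun y => w t y i) j x
          - ∑ j, w t x j * pd (fun y => u t y i) j x) = 0) := by
  have hU : ∀ i, ContDiff ℝ (⊤ : ℕ∞) (fun p : ℝ × (Fin n → ℝ) => u p.1 p.2 i) :=
    fun i => contDiff_pi.1 hu i
  have hW : ∀ i, ContDiff ℝ (⊤ : ℕ∞) (fun p : ℝ × (Fin n → ℝ) => w p.1 p.2 i) :=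
    fun i => contDiff_pi.1 hw i
  have hc : ∀ i, HasCompactSupport (fun p : ℝ × (Fin n → ℝ) => w p.1 p.2 i) :=
    fun i => hwc.comp_left (g := fun v : Fin n → ℝ => v i) rfl
  have hM : ∀ i, ContDiff ℝ (⊤ : ℕ∞) (fun p : ℝ × (Fin n → ℝ) => m p.1 p.2 i) := by
    intro i
    have e : (fun p : ℝ × (Fin n → ℝ) => m p.1 p.2 i) = fun p => u p.1 p.2 i - α ^ 2 *
        ∑ k, fderiv ℝ (fun q => fderiv ℝ (fun p : ℝ × (Fin n → ℝ) => u p.1 p.2 i) q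
          (0, Pi.single k 1)) p (0, Pi.single k 1) := by
      funext p
      rw [hm, lap]
      congr 2
      refine Finset.sum_congr rfl fun k _ => ?_
      have : pd (fun y => u p.1 y i) k = fun y =>
          fderiv ℝ (fun p : ℝ × (Fin n → ℝ) => u p.1 p.2 i) (p.1, y) (0, Pi.single k 1) :=
        funext fun y => pd_slice _ (hU i) p.1 k y
      rw [this]
      exact pd_slice _ (smooth_D (hU i) _) p.1 k p.2
    rw [e]
    refine (hU i).sub (contDiff_const.mul (ContDiff.sum fun k _ => ?_))
    exact smooth_D (smooth_D (hU i) _) _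
  have h := main_aux (fun i p => u p.1 p.2 i) (fun i p => m p.1 p.2 i) (fun i p => w p.1 p.2 i)
    hU hM hW hc _ _ (fun _ => rfl) (fun _ => rfl)
  have pU : ∀ t x i j, pd (fun y => u t y i) j x = _ := fun t x i j => pd_slice _ (hU i) t j x
  have pM : ∀ t x i j, pd (fun y => m t y i) j x = _ := fun t x i j => pd_slice _ (hM i) t j x
  have pW : ∀ t x i j, pd (fun y => w t y i) j x = _ := fun t x i j => pd_slice _ (hW i) t j x
  have dM : ∀ t x i, deriv (fun s => m s x i) t = _ := fun t x i => deriv_slice _ (hM i) t x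
  have dW : ∀ t x i, deriv (fun s => w s x i) t = _ := fun t x i => deriv_slice _ (hW i) t x
  rw [and_iff_left_of_imp]
  · simp only [pU, pM, pW, dM, dW]
    exact h
  · intro H h0
    rw [H]
    simp [h0]
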